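/- arXiv:2508.17359 — 2 statements merged into one kernel-verified Lean document; each statement's English description precedes it below -/
import Mathlib

section
/- For all parameters α > 0, γ > 0, λ ≥ 0, the integral over (0,1) of the UMW density f_Y(y) = (α(−log y)^γ / (log(y) · y^{λ+1})) · (λ log y − γ) · exp(−α(−log y)^γ y^{−λ}) equals 1. -/
open Real MeasureTheory

lemma umw_hasDeriv (α γ l : ℝ) (y : ℝ) (hy0 : 0 < y) (hy1 : y < 1) :
    HasDerivAt (fun y : ℝ => Real.exp (-α * (-Real.log y) ^ γ * y ^ (-l)))
      (α * (-Real.log y) ^ γ / (Real.log y * y ^ (l + 1)) * (l * Real.log y - γ) *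
        Real.exp (-α * (-Real.log y) ^ γ * y ^ (-l))) y := by
  have hL : Real.log y < 0 := Real.log_neg hy0 hy1
  have hL' : 0 < -Real.log y := by linarith
  have h1 : HasDerivAt (fun y : ℝ => (-Real.log y) ^ γ) _ y :=
    (Real.hasDerivAt_log hy0.ne').neg.rpow_const (p := γ) (Or.inl hL'.ne')
  have h2 : HasDerivAt (fun y : ℝ => y ^ (-l)) _ y :=
    Real.hasDerivAt_rpow_const (p := -l) (Or.inl hy0.ne')
  have h3 := ((h1.const_mul (-α)).mul h2).exp
  refine h3.congr_deriv ?_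
  have e1 : (-Real.log y) ^ (γ - 1) = (-Real.log y) ^ γ / (-Real.log y) := by
    rw [Real.rpow_sub_one hL'.ne']
  have e2 : y ^ (-l - 1) = y ^ (-l) / y := Real.rpow_sub_one hy0.ne' _
  have e3 : y ^ (l + 1) = y / y ^ (-l) := by
    rw [Real.rpow_add_one hy0.ne', Real.rpow_neg hy0.le]
    field_simp
  have hp : 0 < y ^ (-l) := Real.rpow_pos_of_pos hy0 _
  simp only [Pi.mul_apply, Pi.neg_apply]
  rw [e1, e2, e3]
  generalize Real.exp _ = E
  have := hL.ne
  field_simp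
  ring

lemma umw_tendsto (α γ l : ℝ) (hα : 0 < α) (hγ : 0 < γ) (hl : 0 ≤ l) :
    Filter.Tendsto (fun y : ℝ => Real.exp (-α * (-Real.log y) ^ γ * y ^ (-l)))
      (nhdsWithin 0 (Set.Ioi 0)) (nhds 0) := by
  have h1 : Filter.Tendsto (fun y : ℝ => α * (-Real.log y) ^ γ)
      (nhdsWithin 0 (Set.Ioi 0)) Filter.atTop :=
    ((tendsto_rpow_atTop hγ).comp
      (Filter.tendsto_neg_atBot_atTop.comp Real.tendsto_log_nhdsGT_zero)).const_mul_atTop hα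
  refine squeeze_zero' (Filter.Eventually.of_forall fun y => (Real.exp_pos _).le) ?_
    (Real.tendsto_exp_neg_atTop_nhds_zero.comp h1)
  filter_upwards [Ioo_mem_nhdsGT (zero_lt_one (α := ℝ))] with y hy
  have hL : Real.log y < 0 := Real.log_neg hy.1 hy.2
  have h2 : 1 ≤ y ^ (-l) :=
    Real.one_le_rpow_of_pos_of_le_one_of_nonpos hy.1 hy.2.le (by linarith)
  have h3 : 0 ≤ α * (-Real.log y) ^ γ :=
    mul_nonneg hα.le (Real.rpow_nonneg (by linarith) _)
  simp only [Function.comp]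
  apply Real.exp_le_exp.2
  nlinarith

/-- The UMW density integrates to one on `(0,1)`: for all parameters `α > 0`,
`γ > 0`, `l ≥ 0` (here `l` stands for `λ`),
`∫_{(0,1)} (α (-log y)^γ / (log y · y^(l+1))) (l log y - γ) exp (-α (-log y)^γ y^(-l)) dy = 1`. -/
theorem umw_pdf_integrates_to_one (α γ l : ℝ) (hα : 0 < α) (hγ : 0 < γ) (hl : 0 ≤ l) :
    ∫ y in Set.Ioo (0 : ℝ) 1,
      α * (-Real.log y) ^ γ / (Real.log y * y ^ (l + 1)) * (l * Real.log y - γ) *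
        Real.exp (-α * (-Real.log y) ^ γ * y ^ (-l)) = 1 := by
  set G : ℝ → ℝ := fun y => Real.exp (-α * (-Real.log y) ^ γ * y ^ (-l)) with hG
  set F : ℝ → ℝ := Function.update G 0 0 with hF
  have hFG : ∀ y : ℝ, 0 < y → F =ᶠ[nhds y] G := by
    intro y hy
    filter_upwards [Ioi_mem_nhds hy] with z hz
    exact Function.update_of_ne (ne_of_gt hz) _ _
  have hcont : ContinuousOn F (Set.Icc 0 1) := by
    intro y hy
    rcases hy.1.eq_or_lt with rfl | h0
    · have : ContinuousWithinAt F (Set.Ici 0) 0 := by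
        rw [hF, continuousWithinAt_update_same]
        have := umw_tendsto α γ l hα hγ hl
        rwa [Set.Ici_sdiff_left]
      exact this.mono Set.Icc_subset_Ici_self
    · apply ContinuousAt.continuousWithinAt
      rw [continuousAt_congr (hFG y h0)]
      have a1 : ContinuousAt (fun y : ℝ => (-Real.log y) ^ γ) y :=
        (Real.continuousAt_log h0.ne').neg.rpow_const (Or.inr hγ.le)
      have a2 : ContinuousAt (fun y : ℝ => y ^ (-l)) y :=
        Real.continuousAt_rpow_const _ _ (Or.inl h0.ne')
      exact ((a1.const_mul (-α)).mul a2).rexp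
  have hder : ∀ y ∈ Set.Ioo (0 : ℝ) 1, HasDerivAt F (α * (-Real.log y) ^ γ / (Real.log y * y ^ (l + 1)) * (l * Real.log y - γ) *
        Real.exp (-α * (-Real.log y) ^ γ * y ^ (-l))) y := fun y hy =>
    (umw_hasDeriv α γ l y hy.1 hy.2).congr_of_eventuallyEq (hFG y hy.1)
  have hint := intervalIntegral.integrableOn_deriv_of_nonneg hcont hder (by
    intro y hy
    have hL : Real.log y < 0 := Real.log_neg hy.1 hy.2
    refine mul_nonneg (mul_nonneg_of_nonpos_of_nonpos ?_ ?_) (Real.exp_pos _).le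
    · apply div_nonpos_of_nonneg_of_nonpos
      · exact mul_nonneg hα.le (Real.rpow_nonneg (by linarith) _)
      · exact mul_nonpos_of_nonpos_of_nonneg hL.le (Real.rpow_nonneg hy.1.le _)
    · nlinarith)
  have := intervalIntegral.integral_eq_sub_of_hasDerivAt_of_le zero_le_one hcont hder
    ((intervalIntegrable_iff_integrableOn_Ioc_of_le zero_le_one).2 hint)
  rw [intervalIntegral.integral_of_le zero_le_one, integral_Ioc_eq_integral_Ioo] at this
  rw [this]
  simp [hF, hG, Real.zero_rpow hγ.ne']
end

section
/- For all parameters α > 0, γ > 0, λ ≥ 0 and every τ ∈ (0,1), there exists a unique μ ∈ (0,1) such that μ^{−λ}(−log μ)^γ + (1/α) log τ = 0; equivalently, the UMW distribution has a unique τ-quantile in (0,1). -/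
open Real

/-- Existence and uniqueness of the UMW `τ`-quantile: for all parameters `α > 0`,
`γ > 0`, `l ≥ 0` (here `l` stands for `λ`) and every `τ ∈ (0,1)`, there exists a
unique `μ ∈ (0,1)` such that `μ^(-l) (-log μ)^γ + (1/α) log τ = 0`. -/
theorem umw_quantile_exists_unique (α γ l : ℝ) (hα : 0 < α) (hγ : 0 < γ) (hl : 0 ≤ l)
    (τ : ℝ) (hτ : τ ∈ Set.Ioo (0 : ℝ) 1) :
    ∃! μ : ℝ, μ ∈ Set.Ioo (0 : ℝ) 1 ∧
      μ ^ (-l) * (-Real.log μ) ^ γ + (1 / α) * Real.log τ = 0 := by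
  obtain ⟨hτ0, hτ1⟩ := hτ
  have hc : 0 < -((1 / α) * Real.log τ) := by
    have h1 := Real.log_neg hτ0 hτ1
    have h2 : 0 < 1 / α := by positivity
    nlinarith
  generalize (1 / α) * Real.log τ = d at hc
  have key : ∀ x : ℝ, (Real.exp (-x)) ^ (-l) * (-Real.log (Real.exp (-x))) ^ γ
      = Real.exp (l * x) * x ^ γ := by
    intro x
    rw [Real.log_exp, ← Real.exp_mul, neg_neg]
    congr 2
    ring
  have mono : ∀ x y : ℝ, 0 < x → x < y →
      Real.exp (l * x) * x ^ γ < Real.exp (l * y) * y ^ γ := by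
    intro x y hx hxy
    have h1 : Real.exp (l * x) ≤ Real.exp (l * y) :=
      Real.exp_le_exp.mpr (mul_le_mul_of_nonneg_left hxy.le hl)
    have h2 : x ^ γ < y ^ γ := Real.rpow_lt_rpow hx.le hxy hγ
    exact mul_lt_mul' h1 h2 (Real.rpow_nonneg hx.le _) (Real.exp_pos _)
  have hcont : Continuous (fun x : ℝ => Real.exp (l * x) * x ^ γ) :=
    (by fun_prop : Continuous fun x : ℝ => Real.exp (l * x)).mul
      (Real.continuous_rpow_const hγ.le)
  set b : ℝ := (-d) ^ (1 / γ) with hb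
  have hb0 : 0 < b := Real.rpow_pos_of_pos hc _
  have hbγ : b ^ γ = -d := by
    rw [hb, ← Real.rpow_mul hc.le, one_div, inv_mul_cancel₀ hγ.ne', Real.rpow_one]
  have hmem : -d ∈ Set.Icc (Real.exp (l * 0) * (0:ℝ) ^ γ) (Real.exp (l * b) * b ^ γ) := by
    constructor
    · rw [Real.zero_rpow hγ.ne', mul_zero]; exact hc.le
    · rw [hbγ]
      exact le_mul_of_one_le_left hc.le (Real.one_le_exp (by positivity))
  obtain ⟨x, ⟨hx0, -⟩, hx⟩ := intermediate_value_Icc hb0.le hcont.continuousOn hmem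
  simp only at hx
  have hxpos : 0 < x := by
    rcases hx0.eq_or_lt with h | h
    · rw [← h, Real.zero_rpow hγ.ne', mul_zero] at hx
      linarith
    · exact h
  refine ⟨Real.exp (-x), ⟨⟨Real.exp_pos _, Real.exp_lt_one_iff.mpr (by linarith)⟩, ?_⟩, ?_⟩
  · rw [key, hx]; ring
  · rintro μ ⟨⟨h0, h1⟩, h⟩
    have hy : 0 < -Real.log μ := by linarith [Real.log_neg h0 h1]
    have hμ : μ = Real.exp (-(-Real.log μ)) := by rw [neg_neg, Real.exp_log h0]
    generalize -Real.log μ = y at hμ hy h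
    subst hμ
    have h' : Real.exp (l * y) * y ^ γ = -d := by
      have := key y
      rw [Real.log_exp, neg_neg] at this
      linarith
    rcases lt_trichotomy x y with hlt | heq | hgt
    · linarith [mono x y hxpos hlt]
    · rw [heq]
    · linarith [mono y x hy hgt]
end
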